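/- Let n ≥ 6 be even, let V_n be the Wagner graph (circulant) on ℤ/nℤ, and let C be its outer cycle. Then the inequality ∑_{e ∈ E(C)} x_e ≤ 4 is facet-defining for BOND(V_n). -/

import Mathlib

open Finset

namespace BondPolytope

variable {V : Type*}

/-- The cut `δ(S)`: edges of `G` with exactly one endpoint in `S`. -/
def cut (G : SimpleGraph V) (S : Set V) : Set (Sym2 V) :=
  {e | e ∈ G.edgeSet ∧ ∃ u w, e = s(u, w) ∧ u ∈ S ∧ w ∉ S}

/-- A set of edges is a cut of `G`. -/
def IsCut (G : SimpleGraph V) (D : Set (Sym2 V)) : Prop :=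
  ∃ S : Set V, D = cut G S

/-- A set of edges is a bond of `G`: it is a cut `δ(S)` such that both sides induce
connected (possibly empty) subgraphs. -/
def IsBond (G : SimpleGraph V) (D : Set (Sym2 V)) : Prop :=
  ∃ S : Set V, D = cut G S ∧ (G.induce S).Preconnected ∧ (G.induce Sᶜ).Preconnected

open Classical in
/-- The indicator vector `x^δ ∈ ℝ^E` of a set `δ` of edges. -/
noncomputable def indVec (G : SimpleGraph V) (D : Set (Sym2 V)) : ↥G.edgeSet → ℝ :=
  fun e => if (e : Sym2 V) ∈ D then 1 else 0

/-- The bond polytope `BOND(G) ⊆ ℝ^E`. -/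
noncomputable def bondPolytope (G : SimpleGraph V) : Set (↥G.edgeSet → ℝ) :=
  convexHull ℝ {x | ∃ D, IsBond G D ∧ x = indVec G D}

/-- The cut polytope `CUT(G) ⊆ ℝ^E`. -/
noncomputable def cutPolytope (G : SimpleGraph V) : Set (↥G.edgeSet → ℝ) :=
  convexHull ℝ {x | ∃ D, IsCut G D ∧ x = indVec G D}

/-- `a^T x`. -/
noncomputable def dot {ι : Type*} [Fintype ι] (a x : ι → ℝ) : ℝ := ∑ i, a i * x i

/-- Affine dimension of a set of points. -/
noncomputable def affDim {W : Type*} [AddCommGroup W] [Module ℝ W] (s : Set W) : ℕ :=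
  Module.finrank ℝ ↥(vectorSpan ℝ s)

/-- `a^T x ≤ b` is facet-defining for `P`. -/
def IsFacet {ι : Type*} [Fintype ι] (P : Set (ι → ℝ)) (a : ι → ℝ) (b : ℝ) : Prop :=
  a ≠ 0 ∧ (∀ x ∈ P, dot a x ≤ b) ∧ {x ∈ P | dot a x = b}.Nonempty ∧
    affDim {x ∈ P | dot a x = b} + 1 = affDim P


/-- The Wagner graph (circulant) `V_n` on `ZMod n`: `i` and `j` are adjacent iff
`i - j ≡ ±1 (mod n)` or `i - j ≡ n/2 (mod n)`. -/
def wagner (n : ℕ) : SimpleGraph (ZMod n) :=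
  SimpleGraph.fromRel (fun i j => i - j = 1 ∨ i - j = (n / 2 : ℕ))


theorem isFacet_of_span_eq_top {ι : Type*} [Fintype ι] {P : Set (ι → ℝ)} {a : ι → ℝ} {b : ℝ}
    (hb : b ≠ 0) (hvalid : ∀ x ∈ P, dot a x ≤ b) (h0 : (0 : ι → ℝ) ∈ P)
    (hne : {x ∈ P | dot a x = b}.Nonempty)
    (hspan : Submodule.span ℝ {x ∈ P | dot a x = b} = ⊤) : IsFacet P a b := by
  let L : Module.Dual ℝ (ι → ℝ) := dotProductBilin ℝ ℝ a
  have hL : ∀ x, L x = dot a x := fun x => rfl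
  obtain ⟨x₀, hx₀⟩ := hne
  have hL0 : L ≠ 0 := by
    intro h
    have := hx₀.2
    rw [← hL, h] at this
    exact hb (by simpa using this.symm)
  have hker : vectorSpan ℝ {x ∈ P | dot a x = b} = LinearMap.ker L := by
    apply le_antisymm
    · rw [vectorSpan_def, Submodule.span_le]
      rintro _ ⟨x, hx, y, hy, rfl⟩
      have : L (x - y) = L x - L y := map_sub L x y
      rw [hL x, hL y, hx.2, hy.2, sub_self] at this
      exact this
    · intro v hv
      have key : ∀ w ∈ Submodule.span ℝ {x ∈ P | dot a x = b},
          w - (L w / b) • x₀ ∈ vectorSpan ℝ {x ∈ P | dot a x = b} := by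
        intro w hw
        induction hw using Submodule.span_induction with
        | mem x hx =>
          have : L x = b := hx.2
          rw [this, div_self hb, one_smul]
          exact vsub_mem_vectorSpan ℝ hx hx₀
        | zero => simp
        | add x y _ _ hx hy =>
          convert add_mem hx hy using 1
          rw [map_add, add_div, add_smul]
          abel
        | smul c x _ hx =>
          convert Submodule.smul_mem _ c hx using 1
          rw [map_smul, smul_sub, smul_smul, smul_eq_mul, mul_div_assoc]
      have := key v (hspan ▸ Submodule.mem_top)
      rw [LinearMap.mem_ker.mp hv] at this
      simpa using this
  have hP : vectorSpan ℝ P = ⊤ := by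
    rw [eq_top_iff, ← hspan, Submodule.span_le]
    intro x hx
    simpa using vsub_mem_vectorSpan ℝ hx.1 h0
  refine ⟨?_, hvalid, ⟨x₀, hx₀⟩, ?_⟩
  · rintro rfl
    exact hL0 (by ext; simp [L])
  · rw [affDim, affDim, hker, hP, finrank_top, Module.Dual.finrank_ker_add_one_of_ne_zero hL0]

theorem card_le_of_induce_fromEdgeSet_preconnected {V : Type*} [Fintype V]
    (S : Finset V) (F : Finset (Sym2 V)) (hS : ((SimpleGraph.fromEdgeSet (F : Set (Sym2 V))).induce
      (S : Set V)).Preconnected) : #S ≤ #F + 1 := by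
  classical
  rcases S.eq_empty_or_nonempty with rfl | hne
  · simp
  have : Nonempty (S : Set V) := hne.to_subtype
  have h := (SimpleGraph.Connected.mk hS).card_vert_le_card_edgeSet_add_one
  rw [Nat.card_coe_set_eq, Set.ncard_coe_finset] at h
  refine h.trans (Nat.add_le_add_right ?_ 1)
  rw [Nat.card_coe_set_eq, ← Set.ncard_coe_finset F]
  refine Set.ncard_le_ncard_of_injOn (Sym2.map Subtype.val) ?_
    (Sym2.map.injective Subtype.val_injective).injOn
  intro e he
  induction e with | _ u v
  simpa using (by simpa using he : s(u.1, v.1) ∈ F ∧ _).1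

theorem preconnected_of_adj_reachable {V : Type*} {G H : SimpleGraph V} (hG : G.Preconnected)
    (h : ∀ u v, G.Adj u v → H.Reachable u v) : H.Preconnected := by
  intro u v
  obtain ⟨p⟩ := hG u v
  induction p with
  | nil => rfl
  | cons huv _ ih => exact (h _ _ huv).trans ih

section Circulant

variable {n : ℕ} {G : SimpleGraph (ZMod n)} {h : ZMod n}

open Classical in
/-- A connected vertex set of a Möbius ladder meets the outer cycle in at most one more arc than
there are runs of rungs inside the set; each such run is counted from both of its ends. -/
theorem two_mul_card_arc_le [NeZero n] (hh : h + h = 0) (hh0 : h ≠ 0) (h1 : (1 : ZMod n) ≠ 0)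
    (hG : ∀ u v, G.Adj u v → v = u + 1 ∨ u = v + 1 ∨ v = u + h)
    (S : Set (ZMod n)) (hS : (G.induce S).Preconnected) :
    2 * #{i | i ∈ S ∧ i + 1 ∉ S} ≤
      #{i | (i + 1 ∈ S ∧ i + 1 + h ∈ S) ∧ ¬ (i ∈ S ∧ i + h ∈ S)} + 2 := by
  by_cases hu : ∃ v, v ∉ S
  swap
  · push Not at hu
    simp [hu]
  obtain ⟨v, hv⟩ := hu
  set R : Finset (ZMod n) := {i | (i + 1 ∈ S ∧ i + 1 + h ∈ S) ∧ ¬ (i ∈ S ∧ i + h ∈ S)} with hR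
  set I : Finset (ZMod n) := {i | i ∈ S ∧ i + 1 ∈ S} with hI
  set E₁ := I.image fun i => s(i, i + 1)
  set E₂ := R.image fun i => s(i + 1, i + 1 + h)
  set H := (SimpleGraph.fromEdgeSet ((E₁ ∪ E₂ : Finset _) : Set (Sym2 (ZMod n)))).induce S
  have outer : ∀ i (hi : i ∈ S) (hi' : i + 1 ∈ S), H.Reachable ⟨i, hi⟩ ⟨i + 1, hi'⟩ := by
    intro i hi hi'
    refine SimpleGraph.Adj.reachable ?_
    have : s(i, i + 1) ∈ E₁ := mem_image_of_mem _ (by simp [hI, hi, hi'])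
    simpa [H, h1] using Or.inl this
  have rung : ∀ (k : ℕ) i (hi : i ∈ S) (hi' : i + h ∈ S), i - k ∉ S →
      H.Reachable ⟨i, hi⟩ ⟨i + h, hi'⟩ := by
    intro k
    induction k with
    | zero => intro i hi _ hk; simp [hi] at hk
    | succ k ih =>
      intro i hi hi' hk
      obtain ⟨j, rfl⟩ : ∃ j, i = j + 1 := ⟨i - 1, by ring⟩
      by_cases hj : j ∈ S ∧ j + h ∈ S
      · have e : j + 1 + h = j + h + 1 := by ring
        have hj' : j + h + 1 ∈ S := e ▸ hi'
        have := ((outer j hj.1 hi).symm.trans (ih j hj.1 hj.2 (by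
          convert hk using 2; push_cast; ring))).trans (outer _ hj.2 hj')
        convert this using 2
      · refine SimpleGraph.Adj.reachable ?_
        have : s(j + 1, j + 1 + h) ∈ E₂ :=
          mem_image_of_mem (fun i => s(i + 1, i + 1 + h)) (by
            simp only [hR, mem_filter, mem_univ, true_and]; exact ⟨⟨hi, hi'⟩, hj⟩)
        simpa [H, hh0] using Or.inr this
  have hH : H.Preconnected := by
    refine preconnected_of_adj_reachable hS ?_
    rintro ⟨a, ha⟩ ⟨b, hb⟩ hab
    rcases hG a b (by simpa using hab) with rfl | rfl | rfl
    · exact outer _ _ _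
    · exact (outer _ _ _).symm
    · exact rung (a - v).val _ _ _ (by simpa using hv)
  have hcard := card_le_of_induce_fromEdgeSet_preconnected
    (S.toFinset) (E₁ ∪ E₂) (by rw [Set.coe_toFinset]; exact hH)
  have hE₁ : #E₁ ≤ #I := card_image_le
  have hE₂ : 2 * #E₂ ≤ #R := by
    refine mul_card_image_le_card _ _ ?_
    intro e he
    obtain ⟨i, hi, rfl⟩ := mem_image.mp he
    refine one_lt_card.mpr ⟨i, by simp [hi], i + h, ?_, by simpa using hh0⟩
    have e1 : i + h + 1 = i + 1 + h := by ring
    have e2 : i + 1 + h + h = i + 1 := by rw [add_assoc, hh, add_zero]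
    have e3 : i + h + h = i := by rw [add_assoc, hh, add_zero]
    simp only [hR, mem_filter, mem_univ, true_and] at hi ⊢
    rw [e1, e2, e3]
    exact ⟨⟨hi.1.symm, fun h => hi.2 h.symm⟩, Sym2.eq_swap⟩
  have hsplit : #I + #{i | i ∈ S ∧ i + 1 ∉ S} = #S.toFinset := by
    have := card_filter_add_card_filter_not (s := S.toFinset) (fun i => i + 1 ∈ S)
    rw [← this]
    congr 2 <;> ext <;> simp [hI]
  have := card_union_le E₁ E₂
  lia

open Classical in
theorem card_outer_cut_le [NeZero n] (hh : h + h = 0) (hh0 : h ≠ 0) (h1 : (1 : ZMod n) ≠ 0)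
    (hG : ∀ u v, G.Adj u v → v = u + 1 ∨ u = v + 1 ∨ v = u + h)
    (S : Set (ZMod n)) (hS : (G.induce S).Preconnected) (hS' : (G.induce Sᶜ).Preconnected) :
    #{i | ¬ (i ∈ S ↔ i + 1 ∈ S)} ≤ 4 := by
  have hA := two_mul_card_arc_le hh hh0 h1 hG S hS
  have hB := two_mul_card_arc_le hh hh0 h1 hG Sᶜ hS'
  simp only [Set.mem_compl_iff, not_not] at hB
  have shift : ∀ (g : ZMod n → ℤ) (c : ZMod n), ∑ i, g (i + c) = ∑ i, g i := fun g c =>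
    Fintype.sum_equiv (Equiv.addRight c) _ _ fun _ => rfl
  let f : ZMod n → ℤ := fun i => if i ∈ S then 1 else 0
  let d : ZMod n → ℤ := fun i => if i ∈ S ∧ i + 1 ∉ S then 1 else 0
  let p : ZMod n → ℤ := fun i => if i ∈ S ∧ i + h ∈ S then 1 else 0
  let q : ZMod n → ℤ := fun i => if i ∉ S ∧ i + h ∉ S then 1 else 0
  have hruns : (#{i | (i + 1 ∈ S ∧ i + 1 + h ∈ S) ∧ ¬ (i ∈ S ∧ i + h ∈ S)} : ℤ) +
      #{i | (i + 1 ∉ S ∧ i + 1 + h ∉ S) ∧ ¬ (i ∉ S ∧ i + h ∉ S)} ≤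
      2 * #{i | i ∈ S ∧ i + 1 ∉ S} := by
    simp only [← sum_boole, ← sum_add_distrib]
    have key : ∑ i : ZMod n, 2 * ((if (i + 1 ∈ S ∧ i + 1 + h ∈ S) ∧ ¬ (i ∈ S ∧ i + h ∈ S)
        then (1 : ℤ) else 0) + if (i + 1 ∉ S ∧ i + 1 + h ∉ S) ∧ ¬ (i ∉ S ∧ i + h ∉ S)
        then 1 else 0) ≤ ∑ i, (2 * (d i + d (i + h)) + (f (i + 1) - f i) +
          (f (i + h + 1) - f (i + h)) + (p (i + 1) - p i) + (q (i + 1) - q i)) := by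
      refine sum_le_sum fun i _ => ?_
      have e : i + h + 1 = i + 1 + h := by ring
      simp only [d, f, p, q, e]
      by_cases a1 : i ∈ S <;> by_cases a2 : i + 1 ∈ S <;> by_cases a3 : i + h ∈ S <;>
        by_cases a4 : i + 1 + h ∈ S <;> simp [a1, a2, a3, a4]
    simp only [sum_add_distrib, sum_sub_distrib, ← mul_sum, shift, shift (fun i => f (i + 1)),
      sub_self] at key ⊢
    have : ∑ i, d i = ∑ i, if i ∈ S ∧ i + 1 ∉ S then (1 : ℤ) else 0 := rfl
    lia
  have hbal : (#{i | i ∈ S ∧ i + 1 ∉ S} : ℤ) = #{i | i ∉ S ∧ i + 1 ∈ S} := by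
    simp only [← sum_boole]
    rw [← sub_eq_zero, ← sum_sub_distrib]
    have : ∑ i, (f i - f (i + 1)) = 0 := by rw [sum_sub_distrib, shift, sub_self]
    refine Eq.trans (sum_congr rfl fun i _ => ?_) this
    simp only [f]
    by_cases a1 : i ∈ S <;> by_cases a2 : i + 1 ∈ S <;> simp [a1, a2]
  have hc : #{i | ¬ (i ∈ S ↔ i + 1 ∈ S)} ≤
      #{i | i ∈ S ∧ i + 1 ∉ S} + #{i | i ∉ S ∧ i + 1 ∈ S} := by
    refine le_trans (card_le_card ?_) (card_union_le _ _)
    intro i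
    simp only [mem_filter, mem_univ, true_and, mem_union]
    tauto
  lia

theorem induce_preconnected_of_descent [NeZero n] {ε r : ZMod n} (hε : ε = 1 ∨ ε = -1)
    (h1 : (1 : ZMod n) ≠ 0) (hh0 : h ≠ 0)
    (hG : ∀ u v, v = u + 1 ∨ u = v + 1 ∨ v = u + h → u ≠ v → G.Adj u v)
    {W : Set (ZMod n)} (hr : r ∈ W) (hrh : r + h ∈ W)
    (hW : ∀ v ∈ W, v = r ∨ v = r + h ∨ v + ε ∈ W) : (G.induce W).Preconnected := by
  have hε0 : ε ≠ 0 := by rcases hε with rfl | rfl <;> simpa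
  have key : ∀ (k : ℕ) v (hv : v ∈ W), v + k * ε = r →
      (G.induce W).Reachable ⟨v, hv⟩ ⟨r, hr⟩ := by
    intro k
    induction k with
    | zero => rintro v hv e; obtain rfl : v = r := by simpa using e
              rfl
    | succ k ih =>
      intro v hv e
      rcases hW v hv with rfl | rfl | hv'
      · rfl
      · refine (SimpleGraph.Adj.reachable ?_).symm
        exact hG _ _ (by simp) (by simpa using hh0)
      · refine SimpleGraph.Reachable.trans (SimpleGraph.Adj.reachable ?_)
          (ih _ hv' (by rw [← e]; push_cast; ring))
        refine hG _ _ ?_ (by simpa using hε0)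
        rcases hε with rfl | rfl <;> simp
  have key' : ∀ v : W, (G.induce W).Reachable v ⟨r, hr⟩ := by
    rintro ⟨v, hv⟩
    rcases hε with rfl | rfl
    · exact key (r - v).val v hv (by simp)
    · exact key (v - r).val v hv (by simp)
  exact fun u v => (key' u).trans (key' v).symm

theorem mk_mem_cut {V : Type*} {G : SimpleGraph V} {S : Set V} {u v : V} :
    s(u, v) ∈ cut G S ↔ G.Adj u v ∧ ¬ (u ∈ S ↔ v ∈ S) := by
  simp only [cut, Set.mem_ofPred_eq, SimpleGraph.mem_edgeSet, and_congr_right_iff]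
  intro _
  constructor
  · rintro ⟨a, b, hab, ha, hb⟩
    rcases Sym2.eq_iff.mp hab with ⟨rfl, rfl⟩ | ⟨rfl, rfl⟩ <;> tauto
  · intro huv
    by_cases hu : u ∈ S
    · exact ⟨u, v, rfl, hu, by tauto⟩
    · exact ⟨v, u, Sym2.eq_swap, by tauto, hu⟩

/-- `G` is the circulant graph on `ZMod n` with steps `1` and `h`, where `h` is an involution far
enough from `0` for the graph to be a Möbius ladder with at least three rungs. -/
structure IsMobiusLadder (G : SimpleGraph (ZMod n)) (h : ZMod n) : Prop where
  add_self : h + h = 0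
  one_ne : (1 : ZMod n) ≠ 0
  two_ne : (2 : ZMod n) ≠ 0
  ne_zero : h ≠ 0
  add_one_ne : h + 1 ≠ 0
  add_two_ne : h + 2 ≠ 0
  adj_iff : ∀ u v, G.Adj u v ↔ u ≠ v ∧ (v = u + 1 ∨ u = v + 1 ∨ v = u + h)

namespace IsMobiusLadder

theorem adj_add_one (hG : IsMobiusLadder G h) (i : ZMod n) : G.Adj i (i + 1) :=
  (hG.adj_iff _ _).mpr ⟨by simpa using hG.one_ne, by simp⟩

theorem adj_add_half (hG : IsMobiusLadder G h) (i : ZMod n) : G.Adj i (i + h) :=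
  (hG.adj_iff _ _).mpr ⟨by simpa using hG.ne_zero, by simp⟩

theorem outer_mem (hG : IsMobiusLadder G h) (i : ZMod n) : s(i, i + 1) ∈ G.edgeSet :=
  hG.adj_add_one i

theorem rung_mem (hG : IsMobiusLadder G h) (i : ZMod n) : s(i, i + h) ∈ G.edgeSet :=
  hG.adj_add_half i

theorem outer_eq_outer_iff (hG : IsMobiusLadder G h) {i j : ZMod n} :
    s(j, j + 1) = s(i, i + 1) ↔ j = i := by
  have := hG.two_ne
  rw [Sym2.eq_iff]
  grind

theorem outer_ne_rung (hG : IsMobiusLadder G h) (i j : ZMod n) : s(j, j + 1) ≠ s(i, i + h) := by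
  have := hG.add_self
  have := hG.add_one_ne
  rw [Ne, Sym2.eq_iff]
  grind

theorem rung_eq_rung_iff (hG : IsMobiusLadder G h) {i j : ZMod n} :
    s(j, j + h) = s(i, i + h) ↔ j = i ∨ j = i + h := by
  have := hG.add_self
  rw [Sym2.eq_iff]
  grind

theorem edge_cases (hG : IsMobiusLadder G h) {e : Sym2 (ZMod n)} (he : e ∈ G.edgeSet) :
    (∃ i, e = s(i, i + 1)) ∨ ∃ i, e = s(i, i + h) := by
  induction e with | _ u v
  rcases ((hG.adj_iff u v).mp he).2 with rfl | rfl | rfl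
  · exact .inl ⟨_, rfl⟩
  · exact .inl ⟨_, Sym2.eq_swap⟩
  · exact .inr ⟨_, rfl⟩

open Classical in
theorem indVec_cut_eq (hG : IsMobiusLadder G h) {S : Set (ZMod n)} {x : G.edgeSet → ℝ}
    (houter : ∀ i, x ⟨s(i, i + 1), hG.outer_mem i⟩ = if i ∈ S ↔ i + 1 ∈ S then 0 else 1)
    (hrung : ∀ i, x ⟨s(i, i + h), hG.rung_mem i⟩ = if i ∈ S ↔ i + h ∈ S then 0 else 1) :
    indVec G (cut G S) = x := by
  ext ⟨e, he⟩
  rcases hG.edge_cases he with ⟨i, rfl⟩ | ⟨i, rfl⟩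
  · simp [indVec, mk_mem_cut, houter, hG.adj_add_one, ite_not]
  · simp [indVec, mk_mem_cut, hrung, hG.adj_add_half, ite_not]

theorem indVec_cut_rung (hG : IsMobiusLadder G h) (i : ZMod n) :
    indVec G (cut G {i + 1, i + 1 + h}) =
      indVec G {s(i, i + 1)} + indVec G {s(i + 1, i + 1 + 1)} +
      indVec G {s(i + h, i + h + 1)} + indVec G {s(i + 1 + h, i + 1 + h + 1)} := by
  obtain ⟨h0, h1, h2, h3, h4, h5, -⟩ := id hG
  apply hG.indVec_cut_eq <;> intro j
  · simp only [indVec, Pi.add_apply, Set.mem_singleton_iff, hG.outer_eq_outer_iff,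
      Set.mem_insert_iff]
    grind
  · simp only [indVec, Pi.add_apply, Set.mem_singleton_iff, (hG.outer_ne_rung _ _).symm,
      Set.mem_insert_iff]
    grind

theorem indVec_cut_triple (hG : IsMobiusLadder G h) (i : ZMod n) :
    indVec G (cut G {i + 1, i + 2, i + 1 + h}) =
      indVec G {s(i, i + 1)} + indVec G {s(i + 2, i + 2 + 1)} +
      indVec G {s(i + h, i + h + 1)} + indVec G {s(i + 1 + h, i + 1 + h + 1)} +
      indVec G {s(i + 2, i + 2 + h)} := by
  obtain ⟨h0, h1, h2, h3, h4, h5, -⟩ := id hG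
  apply hG.indVec_cut_eq <;> intro j
  · simp only [indVec, Pi.add_apply, Set.mem_singleton_iff, hG.outer_eq_outer_iff,
      hG.outer_ne_rung, Set.mem_insert_iff]
    grind
  · simp only [indVec, Pi.add_apply, Set.mem_singleton_iff, (hG.outer_ne_rung _ _).symm,
      hG.rung_eq_rung_iff, Set.mem_insert_iff]
    grind

theorem indVec_cut_square (hG : IsMobiusLadder G h) (i : ZMod n) :
    indVec G (cut G {i + 1, i + 2, i + 1 + h, i + 2 + h}) =
      indVec G {s(i, i + 1)} + indVec G {s(i + 2, i + 2 + 1)} +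
      indVec G {s(i + h, i + h + 1)} + indVec G {s(i + 2 + h, i + 2 + h + 1)} := by
  obtain ⟨h0, h1, h2, h3, h4, h5, -⟩ := id hG
  apply hG.indVec_cut_eq <;> intro j
  · simp only [indVec, Pi.add_apply, Set.mem_singleton_iff, hG.outer_eq_outer_iff,
      Set.mem_insert_iff]
    grind
  · simp only [indVec, Pi.add_apply, Set.mem_singleton_iff, (hG.outer_ne_rung _ _).symm,
      Set.mem_insert_iff]
    grind

theorem isBond_cut (hG : IsMobiusLadder G h) [NeZero n] {S : Set (ZMod n)} {i : ZMod n}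
    (hi : i ∉ S) (hih : i + h ∉ S)
    (hi' : i + 1 ∈ S) (hih' : i + 1 + h ∈ S)
    (hS : S ⊆ {i + 1, i + 2, i + 1 + h, i + 2 + h}) : IsBond G (cut G S) := by
  have hadj : ∀ u v, v = u + 1 ∨ u = v + 1 ∨ v = u + h → u ≠ v → G.Adj u v :=
    fun u v huv hne => (hG.adj_iff u v).mpr ⟨hne, huv⟩
  refine ⟨S, rfl,
    induce_preconnected_of_descent (.inr rfl) hG.one_ne hG.ne_zero hadj hi' hih' ?_,
    induce_preconnected_of_descent (.inl rfl) hG.one_ne hG.ne_zero hadj hi hih ?_⟩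
  · intro v hv
    have := hS hv
    simp only [Set.mem_insert_iff, Set.mem_singleton_iff] at this
    grind
  · intro v hv
    by_contra! hcon
    have := hS (not_not.mp hcon.2.2)
    simp only [Set.mem_insert_iff, Set.mem_singleton_iff, Set.mem_compl_iff] at this hv
    grind

theorem isBond_empty (hG : IsMobiusLadder G h) [NeZero n] : IsBond G ∅ := by
  refine ⟨∅, by simp [cut], fun u => u.2.elim, ?_⟩
  exact induce_preconnected_of_descent (r := 0) (.inl rfl) hG.one_ne hG.ne_zero
    (fun u v huv hne => (hG.adj_iff u v).mpr ⟨hne, huv⟩) (by simp) (by simp) (by simp)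

open Classical in
theorem dot_outer (hG : IsMobiusLadder G h) [NeZero n] [Fintype G.edgeSet] (x : G.edgeSet → ℝ) :
    dot (fun e : G.edgeSet =>
        if ∃ i : ZMod n, (e : Sym2 (ZMod n)) = s(i, i + 1) then (1 : ℝ) else 0) x =
      ∑ i, x ⟨s(i, i + 1), hG.outer_mem i⟩ := by
  symm
  refine Fintype.sum_of_injective (fun i => (⟨s(i, i + 1), hG.outer_mem i⟩ : G.edgeSet))
    ?_ _ _ ?_ ?_
  · intro i j hij
    exact hG.outer_eq_outer_iff.mp (congrArg Subtype.val hij)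
  · intro e he
    beta_reduce
    rw [if_neg, zero_mul]
    rintro ⟨i, hi⟩
    exact he ⟨i, Subtype.ext hi.symm⟩
  · intro i
    beta_reduce
    rw [if_pos ⟨i, rfl⟩, one_mul]

open Classical in
theorem dot_outer_cut_le (hG : IsMobiusLadder G h) [NeZero n] [Fintype G.edgeSet]
    {D : Set (Sym2 (ZMod n))} (hD : IsBond G D) :
    dot (fun e : G.edgeSet =>
        if ∃ i : ZMod n, (e : Sym2 (ZMod n)) = s(i, i + 1) then (1 : ℝ) else 0)
      (indVec G D) ≤ 4 := by
  obtain ⟨S, rfl, hS, hS'⟩ := hD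
  rw [hG.dot_outer]
  simp only [indVec, mk_mem_cut, hG.adj_add_one, true_and, sum_boole]
  exact_mod_cast card_outer_cut_le hG.add_self hG.ne_zero hG.one_ne
    (fun u v huv => ((hG.adj_iff u v).mp huv).2) S hS hS'

/-- The three families of relations satisfied by a functional that vanishes on the bonds
`indVec_cut_rung`, `indVec_cut_triple` and `indVec_cut_square` force it to vanish. -/
theorem eq_zero_of_relations (hG : IsMobiusLadder G h) [NeZero n] {γ σ : ZMod n → ℝ}
    (hσ : ∀ i, σ (i + h) = σ i)
    (hrung : ∀ i, γ i + γ (i + 1) + γ (i + h) + γ (i + 1 + h) = 0)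
    (htriple : ∀ i, γ i + γ (i + 2) + γ (i + h) + γ (i + 1 + h) + σ (i + 2) = 0)
    (hsquare : ∀ i, γ i + γ (i + 2) + γ (i + h) + γ (i + 2 + h) = 0) (i : ZMod n) :
    γ i = 0 ∧ σ i = 0 := by
  have hu : ∀ i, γ i + γ (i + h) = 0 := by
    intro i
    have e : i + 1 + 1 = i + 2 := by ring
    have := hrung (i + 1)
    rw [e] at this
    linarith [hrung i, hsquare i]
  have hstep : ∀ i, γ (i + 1) = γ i ∧ σ (i + 1) = 0 := by
    intro i
    obtain ⟨j, rfl⟩ : ∃ j, i = j + 1 := ⟨i - 1, by ring⟩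
    have e : j + 1 + 1 = j + 2 := by ring
    have e1 : j + h + 2 = j + 2 + h := by ring
    have e2 : j + h + h = j := by rw [add_assoc, hG.add_self, add_zero]
    have e3 : j + h + 1 + h = j + 1 := by linear_combination hG.add_self
    have t := htriple (j + h)
    rw [e1, e2, e3, hσ] at t
    rw [e]
    constructor <;> linarith [htriple j, hu j, hu (j + 1), hu (j + 2)]
  have hconst : ∀ (k : ℕ) i, γ (i + k) = γ i := by
    intro k
    induction k with
    | zero => simp
    | succ k ih => intro i; rw [Nat.cast_succ, ← add_assoc, (hstep _).1, ih]
  constructor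
  · have := hconst h.val i
    rw [ZMod.natCast_zmod_val] at this
    linarith [hu i]
  · simpa using (hstep (i - 1)).2

open Classical in
theorem isFacet_outer (hG : IsMobiusLadder G h) [NeZero n] [Fintype G.edgeSet] : IsFacet (bondPolytope G)
    (fun e : G.edgeSet => if ∃ i : ZMod n, (e : Sym2 (ZMod n)) = s(i, i + 1) then (1 : ℝ) else 0) 4 := by
  obtain ⟨h0, h1, h2, h3, h4, h5, -⟩ := id hG
  set a : G.edgeSet → ℝ :=
    fun e : G.edgeSet => if ∃ i : ZMod n, (e : Sym2 (ZMod n)) = s(i, i + 1) then (1 : ℝ) else 0 with ha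
  have dot_add : ∀ x y, dot a (x + y) = dot a x + dot a y := dotProduct_add a
  have dot_outer : ∀ i, dot a (indVec G {s(i, i + 1)}) = 1 := by
    intro i
    simp [ha, hG.dot_outer, indVec, hG.outer_eq_outer_iff]
  have dot_rung : ∀ i, dot a (indVec G {s(i, i + h)}) = 0 := by
    intro i
    simp [ha, hG.dot_outer, indVec, hG.outer_ne_rung]
  have mem : ∀ {D}, IsBond G D → indVec G D ∈ bondPolytope G :=
    fun hD => subset_convexHull ℝ _ ⟨_, hD, rfl⟩
  have mem_rung : ∀ i, indVec G (cut G {i + 1, i + 1 + h}) ∈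
      {x ∈ bondPolytope G | dot a x = 4} := fun i =>
    ⟨mem (hG.isBond_cut (i := i) (by simp; grind) (by simp; grind) (by simp) (by simp)
      (by intro; simp; grind)), by
      rw [hG.indVec_cut_rung]; simp only [dot_add, dot_outer]; norm_num⟩
  have mem_triple : ∀ i, indVec G (cut G {i + 1, i + 2, i + 1 + h}) ∈
      {x ∈ bondPolytope G | dot a x = 4} := fun i =>
    ⟨mem (hG.isBond_cut (i := i) (by simp; grind) (by simp; grind) (by simp) (by simp)
      (by intro; simp; grind)), by
      rw [hG.indVec_cut_triple]; simp only [dot_add, dot_outer, dot_rung]; norm_num⟩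
  have mem_square : ∀ i, indVec G (cut G {i + 1, i + 2, i + 1 + h, i + 2 + h}) ∈
      {x ∈ bondPolytope G | dot a x = 4} := fun i =>
    ⟨mem (hG.isBond_cut (i := i) (by simp; grind) (by simp; grind) (by simp) (by simp)
      subset_rfl), by
      rw [hG.indVec_cut_square]; simp only [dot_add, dot_outer]; norm_num⟩
  refine isFacet_of_span_eq_top (by norm_num) ?_ ?_ ⟨_, mem_rung 0⟩ ?_
  · have hconv : Convex ℝ {x | dot a x ≤ 4} :=
      convex_halfSpace_le (dotProductBilin ℝ ℝ a).isLinear 4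
    exact convexHull_min (by rintro _ ⟨D, hD, rfl⟩; exact hG.dot_outer_cut_le hD) hconv
  · convert mem hG.isBond_empty
    ext
    simp [indVec]
  · by_contra hne
    obtain ⟨f, hf0, hf⟩ := Submodule.exists_dual_map_eq_bot_of_lt_top
      (lt_top_iff_ne_top.mpr hne) inferInstance
    have hf' : ∀ x ∈ {x ∈ bondPolytope G | dot a x = 4}, f x = 0 := fun x hx => by
      have := Submodule.mem_map_of_mem (f := f) (Submodule.subset_span hx)
      rwa [hf, Submodule.mem_bot] at this
    have hzero := hG.eq_zero_of_relations (γ := fun i => f (indVec G {s(i, i + 1)}))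
      (σ := fun i => f (indVec G {s(i, i + h)}))
      (fun i => by rw [add_assoc, hG.add_self, add_zero, Sym2.eq_swap])
      (fun i => by simpa only [hG.indVec_cut_rung, map_add] using hf' _ (mem_rung i))
      (fun i => by simpa only [hG.indVec_cut_triple, map_add] using hf' _ (mem_triple i))
      (fun i => by simpa only [hG.indVec_cut_square, map_add] using hf' _ (mem_square i))
    apply hf0
    refine LinearMap.pi_ext' fun e => LinearMap.ext_ring ?_
    have hs : (Pi.single e 1 : G.edgeSet → ℝ) = indVec G {e.1} := by
      ext e'
      simp [indVec, Pi.single_apply, Subtype.ext_iff]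
    obtain ⟨e, he⟩ := e
    simp only [LinearMap.comp_apply, LinearMap.single_apply, LinearMap.zero_apply, hs]
    rcases hG.edge_cases he with ⟨i, rfl⟩ | ⟨i, rfl⟩
    · exact (hzero i).1
    · exact (hzero i).2

end IsMobiusLadder

end Circulant

theorem isMobiusLadder_wagner {n : ℕ} [NeZero n] (hn : 6 ≤ n) (heven : Even n) :
    IsMobiusLadder (wagner n) ((n / 2 : ℕ) : ZMod n) := by
  obtain ⟨m, hm⟩ := heven
  have hm2 : n / 2 = m := by lia
  have ne : ∀ k : ℕ, 0 < k → k < n → (k : ZMod n) ≠ 0 := fun k hk hkn h =>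
    (Nat.le_of_dvd hk ((ZMod.natCast_eq_zero_iff k n).mp h)).not_gt hkn
  have hh : (m : ZMod n) + m = 0 := by rw [← Nat.cast_add, ← hm, ZMod.natCast_self]
  rw [hm2]
  refine ⟨hh, ?_, ?_, ne m (by lia) (by lia), ?_, ?_, ?_⟩
  · exact_mod_cast ne 1 (by lia) (by lia)
  · exact_mod_cast ne 2 (by lia) (by lia)
  · exact_mod_cast ne (m + 1) (by lia) (by lia)
  · exact_mod_cast ne (m + 2) (by lia) (by lia)
  · intro u v
    rw [wagner, SimpleGraph.fromRel_adj, hm2]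
    generalize (m : ZMod n) = h at hh
    grind

open scoped Classical in
theorem wagner_outer_cycle_facet (n : ℕ) [NeZero n] (hn : 6 ≤ n) (heven : Even n) :
    IsFacet (bondPolytope (wagner n))
      (fun e => if ∃ i : ZMod n, (e : Sym2 (ZMod n)) = s(i, i + 1) then (1 : ℝ) else 0) 4 :=
  (isMobiusLadder_wagner hn heven).isFacet_outer

end BondPolytope
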